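/- arXiv:2506.08810 — 4 statements merged into one kernel-verified Lean document; each statement's English description precedes it below -/
import Mathlib

section
/- Let H be a finite 3-connected graph. Let G'' be a graph (on a countable vertex set) together with sets A and B of vertices with A ∪ B = V(G'') and A ∩ B = {x,y} for two distinct vertices x,y, such that no vertex of A∖{x,y} is adjacent in G'' to any vertex of B∖{x,y}. If the induced subgraphs G''[A] and G''[B] are both H-free, then G'' is H-free. -/
open SimpleGraph

/-- `G` contains an induced copy of `H`. -/
def HasInducedCopy {α V : Type*} (H : SimpleGraph α) (G : SimpleGraph V) : Prop :=
  Nonempty (H ↪g G)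

/-- `G` is `H`-free: it contains no induced copy of `H`. -/
def IsInducedFree {α V : Type*} (H : SimpleGraph α) (G : SimpleGraph V) : Prop :=
  ¬ HasInducedCopy H G

/-- `H` is 3-connected: it has at least 4 vertices, is connected, and removing any
2 vertices leaves a connected graph. -/
def ThreeConnected {α : Type*} (H : SimpleGraph α) : Prop :=
  4 ≤ Nat.card α ∧ H.Connected ∧
    ∀ s : Set α, s.ncard = 2 → (H.induce (sᶜ : Set α)).Connected

/-- A set of vertices that is closed under adjacency is closed under reachability. -/
theorem SimpleGraph.Reachable.mem_of_adj_closed {V : Type*} {G : SimpleGraph V} {S : Set V}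
    (hS : ∀ u v, G.Adj u v → u ∈ S → v ∈ S) {u v : V} (h : G.Reachable u v) (hu : u ∈ S) :
    v ∈ S := by
  obtain ⟨p⟩ := h
  induction p with
  | nil => exact hu
  | cons hadj _ ih => exact ih (hS _ _ hadj hu)

/-- In a finite 3-connected graph, any two vertices avoiding a set `T` of at most two vertices
are joined by a path avoiding `T`: every vertex set that contains `a` and is closed under
adjacency outside `T` contains `b`. -/
theorem ThreeConnected.mem_of_adj_closed {α : Type*} [Finite α] {H : SimpleGraph α}
    (h3 : ThreeConnected H) {T S : Set α} (hT : T.ncard ≤ 2) {a b : α} (ha : a ∉ T) (hb : b ∉ T)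
    (hS : ∀ u ∉ T, ∀ v ∉ T, H.Adj u v → u ∈ S → v ∈ S) (haS : a ∈ S) : b ∈ S := by
  obtain ⟨hcard, -, hconn⟩ := h3
  have hsub : T ⊆ ({a, b} : Set α)ᶜ := by
    rintro t ht (rfl | rfl)
    exacts [ha ht, hb ht]
  have hcompl : 2 ≤ (({a, b} : Set α)ᶜ).ncard := by
    have h₁ := Set.ncard_add_ncard_compl ({a, b} : Set α)
    have h₂ : ({a, b} : Set α).ncard ≤ 2 := by
      simpa using Set.ncard_insert_le a {b}
    omega
  obtain ⟨U, hTU, hUab, hU⟩ := Set.exists_subsuperset_card_eq hsub hT hcompl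
  have haU : a ∈ Uᶜ := fun h => hUab h (Or.inl rfl)
  have hbU : b ∈ Uᶜ := fun h => hUab h (Or.inr rfl)
  have hreach := (hconn U hU).preconnected ⟨a, haU⟩ ⟨b, hbU⟩
  refine hreach.mem_of_adj_closed (S := Subtype.val ⁻¹' S) ?_ haS
  rintro ⟨u, hu⟩ ⟨v, hv⟩ huv huS
  exact hS u (fun h => hu (hTU h)) v (fun h => hv (hTU h)) huv huS

/-- An induced copy of `H` in `G` all of whose vertices lie in `S` is an induced copy of `H`
in `G.induce S`. -/
theorem hasInducedCopy_induce {α V : Type*} {H : SimpleGraph α} {G : SimpleGraph V}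
    (f : H ↪g G) {S : Set V} (hf : ∀ u, f u ∈ S) : HasInducedCopy H (G.induce S) :=
  ⟨⟨⟨fun u => ⟨f u, hf u⟩, fun _ _ h => f.injective (congrArg Subtype.val h)⟩,
    f.map_rel_iff⟩⟩

/-- **Observation 4.3.** If `H` is a finite 3-connected graph and `G''` is obtained by
gluing two `H`-free graphs along a pair of vertices `x, y`, then `G''` is `H`-free. -/
theorem stmt_4 {α W : Type*} [Fintype α] [Countable W] (H : SimpleGraph α)
    (h3 : ThreeConnected H) (G'' : SimpleGraph W) (A B : Set W) (x y : W)
    (hxy : x ≠ y) (hcover : A ∪ B = Set.univ) (hmeet : A ∩ B = {x, y})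
    (hsep : ∀ a ∈ A \ ({x, y} : Set W), ∀ b ∈ B \ ({x, y} : Set W), ¬ G''.Adj a b)
    (hA : IsInducedFree H (G''.induce A)) (hB : IsInducedFree H (G''.induce B)) :
    IsInducedFree H G'' := by
  rintro ⟨f⟩
  have hmem : ∀ w, w ∈ A ∨ w ∈ B := fun w => Set.eq_univ_iff_forall.1 hcover w
  have hxyA : ({x, y} : Set W) ⊆ A := hmeet ▸ Set.inter_subset_left
  have hxyB : ({x, y} : Set W) ⊆ B := hmeet ▸ Set.inter_subset_right
  obtain ⟨b, hb⟩ : ∃ b, f b ∉ A := by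
    by_contra! h
    exact hA (hasInducedCopy_induce f h)
  obtain ⟨a, ha⟩ : ∃ a, f a ∉ B := by
    by_contra! h
    exact hB (hasInducedCopy_induce f h)
  have hT : (f ⁻¹' {x, y}).ncard ≤ 2 := by
    rw [← Set.ncard_image_of_injective _ f.injective]
    exact (Set.ncard_le_ncard (Set.image_preimage_subset _ _) (Set.toFinite _)).trans
      (by rw [Set.ncard_pair hxy])
  refine hb (h3.mem_of_adj_closed (S := f ⁻¹' A) hT (fun h => ha (hxyB h))
    (fun h => hb (hxyA h)) ?_ ((hmem _).resolve_right ha))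
  intro u hu v hv huv huA
  by_contra hvA
  exact hsep _ ⟨huA, hu⟩ _ ⟨(hmem _).resolve_left hvA, hv⟩ (f.map_rel_iff.2 huv)
end

section
/- Let H be a finite graph on at least 12 vertices. Then H or its complement contains a 3-connected graph on at least 5 vertices as a (not necessarily induced) subgraph. -/
/-- `G` contains `S` as a (not necessarily induced) subgraph. -/
def ContainsSub {β α : Type*} (S : SimpleGraph β) (G : SimpleGraph α) : Prop :=
  ∃ f : β → α, Function.Injective f ∧ ∀ u v : β, S.Adj u v → G.Adj (f u) (f v)

/-- A disconnected graph has a vertex set with no edges to its complement, both nonempty. -/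
theorem SimpleGraph.exists_cut_of_not_connected {β : Type*} [Nonempty β] {H : SimpleGraph β}
    (h : ¬ H.Connected) :
    ∃ (P : Set β) (u v : β), u ∈ P ∧ v ∉ P ∧ ∀ x ∈ P, ∀ y ∉ P, ¬ H.Adj x y := by
  have h' : ¬ H.Preconnected := fun hp => h ⟨hp⟩
  simp only [SimpleGraph.Preconnected, not_forall] at h'
  obtain ⟨u, v, huv⟩ := h'
  exact ⟨{w | H.Reachable u w}, u, v, SimpleGraph.Reachable.refl u, huv,
    fun x hx y hy hxy => hy (SimpleGraph.Reachable.trans hx hxy.reachable)⟩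

/-- A graph on at least five vertices that is not 3-connected has a separation of order two. -/
theorem exists_separation_of_not_threeConnected {β : Type*} [Fintype β] {H : SimpleGraph β}
    (hβ : 5 ≤ Fintype.card β) (h : ¬ ThreeConnected H) :
    ∃ (S : Finset β) (P : Set β) (u v : β), S.card = 2 ∧ u ∉ S ∧ v ∉ S ∧ u ∈ P ∧ v ∉ P ∧
      ∀ x ∈ P, ∀ y ∉ P, x ∉ S → y ∉ S → ¬ H.Adj x y := by
  classical
  have : Nonempty β := Fintype.card_pos_iff.mp (by omega)
  by_cases hc : H.Connected
  · have h4 : 4 ≤ Nat.card β := by rw [Nat.card_eq_fintype_card]; omega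
    simp only [ThreeConnected, h4, hc, true_and, not_forall] at h
    obtain ⟨s, hs, hn⟩ := h
    have hne : Nonempty (sᶜ : Set β) := by
      by_contra hemp
      rw [Set.nonempty_coe_sort, Set.not_nonempty_iff_eq_empty, Set.compl_empty_iff] at hemp
      rw [hemp, Set.ncard_univ, Nat.card_eq_fintype_card] at hs
      omega
    obtain ⟨P, u, v, hu, hv, hP⟩ := SimpleGraph.exists_cut_of_not_connected hn
    refine ⟨s.toFinset, Subtype.val '' P, u, v, ?_, ?_, ?_, ⟨u, hu, rfl⟩, ?_, ?_⟩
    · rw [← hs, Set.ncard_eq_toFinset_card']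
    · exact fun hm => u.2 (Set.mem_toFinset.mp hm)
    · exact fun hm => v.2 (Set.mem_toFinset.mp hm)
    · rintro ⟨w, hw, hwv⟩
      exact hv (Subtype.ext hwv ▸ hw)
    · rintro _ ⟨x, hx, rfl⟩ y hy - hys hxy
      rw [Set.mem_toFinset] at hys
      exact hP x hx ⟨y, hys⟩ (fun hm => hy ⟨_, hm, rfl⟩) hxy
  · obtain ⟨P, u, v, hu, hv, hP⟩ := SimpleGraph.exists_cut_of_not_connected hc
    have hcard : 2 ≤ (({u, v} : Finset β)ᶜ).card := by
      have := Finset.card_le_two (a := u) (b := v)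
      rw [Finset.card_compl]
      omega
    obtain ⟨S, hS, hS2⟩ := Finset.exists_subset_card_eq hcard
    refine ⟨S, P, u, v, hS2, fun hm => ?_, fun hm => ?_, hu, hv,
      fun x hx y hy _ _ => hP x hx y hy⟩
    · simpa using hS hm
    · simpa using hS hm

open scoped Classical in
/-- The number of ordered pairs of adjacent vertices within a finite vertex set. -/
noncomputable def SimpleGraph.dartCountOn {α : Type*} (G : SimpleGraph α) (A : Finset α) : ℕ :=
  (A.offDiag.filter fun p => G.Adj p.1 p.2).card

theorem SimpleGraph.dartCountOn_le {α : Type*} (G : SimpleGraph α) (A : Finset α) :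
    G.dartCountOn A ≤ A.card * A.card - A.card := by
  classical
  rw [← Finset.offDiag_card]
  exact Finset.card_filter_le _ _

theorem SimpleGraph.dartCountOn_add_compl {α : Type*} (G : SimpleGraph α) (A : Finset α) :
    G.dartCountOn A + Gᶜ.dartCountOn A = A.card * A.card - A.card := by
  classical
  rw [← Finset.offDiag_card,
    ← Finset.card_filter_add_card_filter_not (s := A.offDiag) (fun p => G.Adj p.1 p.2)]
  unfold SimpleGraph.dartCountOn
  congr 2
  · ext p
    simp only [Finset.mem_filter, Finset.mem_offDiag, SimpleGraph.compl_adj]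
    tauto

/-- A graph with no 3-connected subgraph on at least five vertices has at most `3 n - 6` edges
on any `n ≥ 3` vertices. -/
theorem SimpleGraph.dartCountOn_add_le {α : Type*} (G : SimpleGraph α)
    (hG : ∀ (n : ℕ) (S : SimpleGraph (Fin n)), 5 ≤ n → ThreeConnected S → ¬ ContainsSub S G)
    (A : Finset α) (hA : 3 ≤ A.card) : G.dartCountOn A + 12 ≤ 6 * A.card := by
  classical
  induction hn : A.card using Nat.strong_induction_on generalizing A with
  | _ n ih =>
  rcases Nat.lt_or_ge n 5 with h5 | h5
  · have h := G.dartCountOn_le A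
    rw [hn] at h hA
    interval_cases n <;> omega
  let f : Fin n ↪ α := (A.equivFinOfCardEq hn).symm.toEmbedding.trans (Function.Embedding.subtype _)
  have hf : ∀ a ∈ A, ∃ i, f i = a := fun a ha =>
    ⟨A.equivFinOfCardEq hn ⟨a, ha⟩, by simp [f]⟩
  have hnot : ¬ ThreeConnected (G.comap f) := fun h =>
    hG n _ h5 h ⟨f, f.injective, fun _ _ h => h⟩
  obtain ⟨S, P, u, v, hS, huS, hvS, hu, hv, hP⟩ :=
    exists_separation_of_not_threeConnected (by simpa using h5) hnot
  let X : Finset (Fin n) := Finset.univ.filter fun i => i ∈ P ∨ i ∈ S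
  let Y : Finset (Fin n) := Finset.univ.filter fun i => i ∉ P ∨ i ∈ S
  have hX : 3 ≤ X.card := by
    refine Nat.succ_le_of_lt ?_
    rw [← hS]
    exact Finset.card_lt_card ((Finset.ssubset_iff_of_subset fun i hi => by simp [X, hi]).2
      ⟨u, by simp [X, hu], huS⟩)
  have hY : 3 ≤ Y.card := by
    refine Nat.succ_le_of_lt ?_
    rw [← hS]
    exact Finset.card_lt_card ((Finset.ssubset_iff_of_subset fun i hi => by simp [Y, hi]).2
      ⟨v, by simp [Y, hv], hvS⟩)
  have hXY : X.card + Y.card = n + 2 := by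
    have hunion : X ∪ Y = Finset.univ := by
      ext i
      simp only [X, Y, Finset.mem_union, Finset.mem_filter, Finset.mem_univ, true_and, iff_true]
      tauto
    have hinter : X ∩ Y = S := by
      ext i
      simp only [X, Y, Finset.mem_inter, Finset.mem_filter, Finset.mem_univ, true_and]
      tauto
    rw [← Finset.card_union_add_card_inter, hunion, hinter, hS, Finset.card_fin]
  have hsum : G.dartCountOn A ≤ G.dartCountOn (X.map f) + G.dartCountOn (Y.map f) := by
    unfold SimpleGraph.dartCountOn
    refine (Finset.card_le_card ?_).trans (Finset.card_union_le _ _)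
    rintro ⟨a, b⟩ hab
    simp only [Finset.mem_filter, Finset.mem_offDiag] at hab
    obtain ⟨⟨ha, hb, hne⟩, hadj⟩ := hab
    obtain ⟨i, rfl⟩ := hf a ha
    obtain ⟨j, rfl⟩ := hf b hb
    have hcases : (i ∈ X ∧ j ∈ X) ∨ (i ∈ Y ∧ j ∈ Y) := by
      have h₁ : i ∈ P → j ∉ P → i ∉ S → j ∉ S → False := fun hi hj his hjs =>
        hP i hi j hj his hjs hadj
      have h₂ : j ∈ P → i ∉ P → j ∉ S → i ∉ S → False := fun hj hi hjs his =>
        hP j hj i hi hjs his hadj.symm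
      simp only [X, Y, Finset.mem_filter, Finset.mem_univ, true_and]
      by_cases i ∈ P <;> by_cases j ∈ P <;> by_cases i ∈ S <;> by_cases j ∈ S <;> simp_all
    simp only [Finset.mem_union, Finset.mem_filter, Finset.mem_offDiag, Finset.mem_map']
    exact hcases.imp (fun h => ⟨⟨h.1, h.2, hne⟩, hadj⟩) (fun h => ⟨⟨h.1, h.2, hne⟩, hadj⟩)
  have hiX := ih X.card (by omega) (X.map f) (by simpa using hX) (by simp)
  have hiY := ih Y.card (by omega) (Y.map f) (by simpa using hY) (by simp)
  omega

/-- **Lemma 5.3.** Every finite graph on at least 12 vertices is such that it or its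
complement contains a 3-connected graph on at least 5 vertices as a subgraph. -/
theorem stmt_11 {α : Type*} [Fintype α] (H : SimpleGraph α)
    (hcard : 12 ≤ Fintype.card α) :
    ∃ (n : ℕ) (S : SimpleGraph (Fin n)), 5 ≤ n ∧ ThreeConnected S ∧
      (ContainsSub S H ∨ ContainsSub S (Hᶜ)) := by
  by_contra! hcon
  obtain ⟨A, -, hA⟩ := Finset.exists_subset_card_eq (s := (Finset.univ : Finset α)) hcard
  have h₁ := H.dartCountOn_add_le (fun n S hn hS => (hcon n S hn hS).1) A (by omega)
  have h₂ := Hᶜ.dartCountOn_add_le (fun n S hn hS => (hcon n S hn hS).2) A (by omega)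
  have h₃ := H.dartCountOn_add_compl A
  rw [hA] at h₁ h₂ h₃
  omega
end

section
/- Let H be a finite graph containing an induced subgraph on at least 5 vertices that is 3-connected and not a clique. Then either for H or for its complement the following holds: there is a 3*-core deletion sequence from it to an induced subgraph C which is 3-connected, not a clique, and admits no further 3*-core deletion (C has no vertex with at most 2 neighbours and no pair of vertices u,v with |N[u] ∪ N[v]| ≤ 4). -/
/-- One step of the `3*`-core deletion procedure on the induced subgraph of `H` on `s`:
delete a single vertex with at most 2 neighbours, or a pair of vertices `u,v` with
`|N[u] ∪ N[v]| ≤ 4` (all within the current induced subgraph). -/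
def StarStep {α : Type*} (H : SimpleGraph α) (s t : Set α) : Prop :=
  (∃ x ∈ s, t = s \ {x} ∧ (H.neighborSet x ∩ s).ncard ≤ 2) ∨
  (∃ u ∈ s, ∃ v ∈ s, u ≠ v ∧ t = s \ {u, v} ∧
    (((H.neighborSet u ∪ H.neighborSet v) ∩ s) ∪ {u, v}).ncard ≤ 4)

/-- There is a `3*`-core deletion sequence from `H` to the induced subgraph of `H` on `s`. -/
def StarCoreSeq {α : Type*} (H : SimpleGraph α) (s : Set α) : Prop :=
  Relation.ReflTransGen (StarStep H) Set.univ s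

/-- A graph all of whose pairs of distinct vertices are adjacent. -/
def IsCliqueGraph {α : Type*} (H : SimpleGraph α) : Prop :=
  ∀ u v : α, u ≠ v → H.Adj u v

/-- There is a `3*`-core deletion sequence from `K` to an induced subgraph which is
3-connected, not a clique, and admits no further `3*`-core deletion. -/
def GoodStarCore {α : Type*} (K : SimpleGraph α) : Prop :=
  ∃ s : Set α, StarCoreSeq K s ∧ ThreeConnected (K.induce s) ∧
    ¬ IsCliqueGraph (K.induce s) ∧ ∀ t : Set α, ¬ StarStep K s t

/-- The induced subgraph of `K` on `s` splits as `A ∪ B ∪ T`, where `T` has at most two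
vertices and separates `A` from `B`. -/
structure IsSmallSeparation {α : Type*} (K : SimpleGraph α) (s A B T : Set α) : Prop where
  union_eq : A ∪ B ∪ T = s
  disjoint_left_right : Disjoint A B
  disjoint_left_sep : Disjoint A T
  disjoint_right_sep : Disjoint B T
  ncard_sep_le : T.ncard ≤ 2
  not_adj : ∀ a ∈ A, ∀ b ∈ B, ¬ K.Adj a b

theorem IsSmallSeparation.symm {α : Type*} {K : SimpleGraph α} {s A B T : Set α}
    (h : IsSmallSeparation K s A B T) : IsSmallSeparation K s B A T where
  union_eq := by rw [Set.union_comm B A, h.union_eq]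
  disjoint_left_right := h.disjoint_left_right.symm
  disjoint_left_sep := h.disjoint_right_sep
  disjoint_right_sep := h.disjoint_left_sep
  ncard_sep_le := h.ncard_sep_le
  not_adj := fun b hb a ha hab => h.not_adj a ha b hb hab.symm

/-- A connected graph has an edge leaving any nonempty proper set of vertices. -/
theorem SimpleGraph.Connected.exists_adj_of_mem_of_notMem {β : Type*} {G : SimpleGraph β}
    (hG : G.Connected) {X : Set β} {x y : β} (hx : x ∈ X) (hy : y ∉ X) :
    ∃ a ∈ X, ∃ b ∉ X, G.Adj a b := by
  obtain ⟨p⟩ := hG.preconnected x y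
  obtain ⟨d, -, h1, h2⟩ := p.exists_boundary_dart X hx hy
  exact ⟨d.fst, h1, d.snd, h2, d.adj⟩

/-- A nonempty disconnected graph has a nonempty proper set of vertices that no edge leaves. -/
theorem SimpleGraph.exists_isolated_set_of_not_connected {β : Type*} [Nonempty β]
    {G : SimpleGraph β} (hG : ¬ G.Connected) :
    ∃ X : Set β, X.Nonempty ∧ Xᶜ.Nonempty ∧ ∀ a ∈ X, ∀ b ∉ X, ¬ G.Adj a b := by
  rw [SimpleGraph.connected_iff] at hG
  have hp : ¬ G.Preconnected := fun h => hG ⟨h, inferInstance⟩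
  simp only [SimpleGraph.Preconnected, not_forall] at hp
  obtain ⟨u, v, huv⟩ := hp
  refine ⟨{w | G.Reachable u w}, ⟨u, SimpleGraph.Reachable.refl u⟩, ⟨v, huv⟩, ?_⟩
  intro a ha b hb hab
  exact hb (SimpleGraph.Reachable.trans ha hab.reachable)

/-- In a 3-connected graph on at least five vertices, a nonempty set of at most two vertices
has more than two outside neighbours. -/
theorem ThreeConnected.two_lt_ncard_of_boundary_subset {β : Type*} [Finite β]
    {G : SimpleGraph β} (hG : ThreeConnected G) (h5 : 5 ≤ Nat.card β) {X Y : Set β}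
    (hX : X.Nonempty) (hX2 : X.ncard ≤ 2) (hXY : Disjoint X Y)
    (hadj : ∀ a ∈ X, ∀ b ∉ X, G.Adj a b → b ∈ Y) : 2 < Y.ncard := by
  by_contra! hY
  have hc := Set.ncard_add_ncard_compl X
  obtain ⟨T, hYT, hTX, hT⟩ := Set.exists_subsuperset_card_eq
    (Set.subset_compl_iff_disjoint_left.2 hXY) hY (by omega : 2 ≤ Xᶜ.ncard)
  obtain ⟨x, hx⟩ := hX
  obtain ⟨w, hwX, hwT⟩ : ∃ w ∈ Xᶜ, w ∉ T :=
    Set.exists_mem_notMem_of_ncard_lt_ncard (by omega)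
  have hxT : x ∈ Tᶜ := fun h => hTX h hx
  obtain ⟨a, ha, b, hb, hab⟩ := (hG.2.2 T hT).exists_adj_of_mem_of_notMem
    (X := {z : (Tᶜ : Set β) | z.1 ∈ X}) (x := ⟨x, hxT⟩) (y := ⟨w, hwT⟩) hx hwX
  exact b.2 (hYT (hadj a.1 ha b.1 hb hab))

/-- A 3-connected induced subgraph on at least five vertices admits no deletion. -/
theorem ThreeConnected.not_starStep {α : Type*} [Finite α] {K : SimpleGraph α} {s : Set α}
    (hs : ThreeConnected (K.induce s)) (h5 : 5 ≤ s.ncard) (t : Set α) : ¬ StarStep K s t := by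
  have key : ∀ X Y : Set α, X ⊆ s → Y ⊆ s → X.Nonempty → X.ncard ≤ 2 → Disjoint X Y →
      (∀ a ∈ X, ∀ b ∈ s, b ∉ X → K.Adj a b → b ∈ Y) → 2 < Y.ncard := by
    intro X Y hXs hYs hX hX2 hXY hadj
    have hcard : ∀ Z : Set α, Z ⊆ s → (Subtype.val ⁻¹' Z : Set s).ncard = Z.ncard := by
      intro Z hZ
      rw [← Set.ncard_image_of_injective _ Subtype.val_injective,
        Subtype.image_preimage_coe, Set.inter_eq_right.2 hZ]
    rw [← hcard Y hYs]
    obtain ⟨x, hx⟩ := hX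
    refine hs.two_lt_ncard_of_boundary_subset h5 (X := Subtype.val ⁻¹' X)
      ⟨⟨x, hXs hx⟩, hx⟩ (by rwa [hcard X hXs]) (hXY.preimage _) ?_
    intro a ha b hb hab
    exact hadj a.1 ha b.1 b.2 hb hab
  rintro (⟨x, hx, -, hd⟩ | ⟨u, hu, v, hv, huv, -, hd⟩)
  · have := key {x} (K.neighborSet x ∩ s) (by simpa using hx) Set.inter_subset_right
      (Set.singleton_nonempty x) (by simp) (by simp) (by
        rintro a rfl b hb - hab
        exact ⟨hab, hb⟩)
    omega
  · have := key {u, v} (((K.neighborSet u ∪ K.neighborSet v) ∩ s ∪ {u, v}) \ {u, v})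
      (by rintro z (rfl | rfl) <;> assumption)
      (by rintro z ⟨hz | hz, hz'⟩; exacts [hz.2, (hz' hz).elim])
      ⟨u, by simp⟩ (Set.ncard_pair huv).le Set.disjoint_sdiff_right (by
        rintro a (rfl | rfl) b hb hbn hab
        · exact ⟨Or.inl ⟨Or.inl hab, hb⟩, hbn⟩
        · exact ⟨Or.inl ⟨Or.inr hab, hb⟩, hbn⟩)
    rw [Set.ncard_sdiff Set.subset_union_right, Set.ncard_pair huv] at this
    omega

theorem StarStep.subset {α : Type*} {K : SimpleGraph α} {s t : Set α} (h : StarStep K s t) :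
    t ⊆ s := by
  rcases h with ⟨x, -, rfl, -⟩ | ⟨u, -, v, -, -, rfl, -⟩ <;> exact Set.sdiff_subset

theorem StarStep.ncard_lt {α : Type*} [Finite α] {K : SimpleGraph α} {s t : Set α}
    (h : StarStep K s t) : t.ncard < s.ncard := by
  rcases h with ⟨x, hx, rfl, -⟩ | ⟨u, hu, v, -, -, rfl, -⟩
  · exact Set.ncard_sdiff_singleton_lt_of_mem hx
  · refine Set.ncard_lt_ncard ⟨Set.sdiff_subset, fun hle => ?_⟩
    exact (hle hu).2 (Set.mem_insert u {v})

/-- If the induced subgraph on `r` admits no deletion, it survives deletions from larger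
induced subgraphs. -/
theorem StarStep.subset_of_stuck {α : Type*} [Finite α] {K : SimpleGraph α} {r s t : Set α}
    (hr : ∀ t, ¬ StarStep K r t) (hrs : r ⊆ s) (h : StarStep K s t) : r ⊆ t := by
  have hdeg : ∀ x ∈ r, 2 < (K.neighborSet x ∩ r).ncard := fun x hx => by
    by_contra! hle
    exact hr _ (Or.inl ⟨x, hx, rfl, hle⟩)
  have hone : ∀ x ∈ r, ∀ y ∉ r, 4 < (K.neighborSet x ∩ s ∪ {x, y}).ncard := fun x hx y hy => by
    have h1 : (insert y (insert x (K.neighborSet x ∩ r))).ncard ≤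
        (K.neighborSet x ∩ s ∪ {x, y}).ncard := Set.ncard_le_ncard (by
      rintro z (rfl | rfl | hz)
      · simp
      · simp
      · exact Or.inl ⟨hz.1, hrs hz.2⟩)
    rw [Set.ncard_insert_of_notMem, Set.ncard_insert_of_notMem] at h1
    · have := hdeg x hx
      omega
    · simp
    · rintro (rfl | hz)
      exacts [hy hx, hy hz.2]
  rcases h with ⟨x, hx, rfl, hd⟩ | ⟨u, hu, v, hv, huv, rfl, hd⟩
  · refine Set.subset_sdiff_singleton hrs fun hxr => ?_
    have := Set.ncard_le_ncard (Set.inter_subset_inter_right (K.neighborSet x) hrs)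
    have := hdeg x hxr
    omega
  · have hnot : u ∉ r ∧ v ∉ r := by
      by_cases hur : u ∈ r <;> by_cases hvr : v ∈ r
      · refine (hr _ (Or.inr ⟨u, hur, v, hvr, huv, rfl, ?_⟩)).elim
        refine (Set.ncard_le_ncard ?_).trans hd
        gcongr
      · have h1 := hone u hur v hvr
        have h2 : (K.neighborSet u ∩ s ∪ {u, v}).ncard ≤
            ((K.neighborSet u ∪ K.neighborSet v) ∩ s ∪ {u, v}).ncard := by
          refine Set.ncard_le_ncard ?_
          gcongr
          exact Set.subset_union_left
        omega
      · have h1 := hone v hvr u hur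
        have h2 : (K.neighborSet v ∩ s ∪ {v, u}).ncard ≤
            ((K.neighborSet u ∪ K.neighborSet v) ∩ s ∪ {u, v}).ncard := by
          refine Set.ncard_le_ncard ?_
          rw [Set.pair_comm v u]
          gcongr
          exact Set.subset_union_right
        omega
      · exact ⟨hur, hvr⟩
    rintro z hz
    refine ⟨hrs hz, ?_⟩
    rintro (rfl | rfl)
    exacts [hnot.1 hz, hnot.2 hz]

theorem StarCoreSeq.subset_of_stuck {α : Type*} [Finite α] {K : SimpleGraph α} {r s : Set α}
    (h : StarCoreSeq K s) (hr : ∀ t, ¬ StarStep K r t) : r ⊆ s := by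
  induction h with
  | refl => exact Set.subset_univ r
  | tail _ hstep ih => exact hstep.subset_of_stuck hr ih

theorem exists_starCoreSeq_stuck {α : Type*} [Finite α] (K : SimpleGraph α) :
    ∃ s, StarCoreSeq K s ∧ ∀ t, ¬ StarStep K s t := by
  obtain ⟨s, hs, hmin⟩ := Set.exists_min_image {s | StarCoreSeq K s} Set.ncard
    (Set.toFinite _) ⟨Set.univ, Relation.ReflTransGen.refl⟩
  exact ⟨s, hs, fun t ht => (hmin t (hs.tail ht)).not_gt ht.ncard_lt⟩

/-- A deleted vertex has at most three neighbours among the surviving vertices. -/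
theorem StarCoreSeq.ncard_neighborSet_inter_le {α : Type*} [Finite α] {K : SimpleGraph α}
    {s : Set α} (h : StarCoreSeq K s) {b : α} (hb : b ∉ s) :
    (K.neighborSet b ∩ s).ncard ≤ 3 := by
  have key : ∀ r, Relation.ReflTransGen (StarStep K) r s →
      s ⊆ r ∧ (b ∈ r → (K.neighborSet b ∩ s).ncard ≤ 3) := by
    intro r hr
    induction hr using Relation.ReflTransGen.head_induction_on with
    | refl => exact ⟨subset_rfl, fun h => (hb h).elim⟩
    | @head r t hstep _ ih =>
      have hsr : s ⊆ r := ih.1.trans hstep.subset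
      refine ⟨hsr, fun hbr => ?_⟩
      by_cases hbt : b ∈ t
      · exact ih.2 hbt
      have hsub : ∀ Z : Set α, (K.neighborSet b ∩ r) ∪ {b} ⊆ Z → Z.ncard ≤ 4 →
          (K.neighborSet b ∩ s).ncard ≤ 3 := by
        intro Z hZ hZ4
        have h1 : (insert b (K.neighborSet b ∩ s)).ncard ≤ Z.ncard :=
          Set.ncard_le_ncard (by
            rintro z (rfl | hz)
            · exact hZ (Or.inr rfl)
            · exact hZ (Or.inl ⟨hz.1, hsr hz.2⟩))
        rw [Set.ncard_insert_of_notMem (by simp)] at h1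
        omega
      rcases hstep with ⟨x, hx, rfl, hd⟩ | ⟨u, hu, v, hv, huv, rfl, hd⟩
      · obtain rfl : b = x := by
          by_contra hne
          exact hbt ⟨hbr, hne⟩
        have := Set.ncard_le_ncard (Set.inter_subset_inter_right (K.neighborSet b) hsr)
        omega
      · have hbuv : b = u ∨ b = v := by
          by_contra hne
          exact hbt ⟨hbr, hne⟩
        refine hsub _ ?_ hd
        rcases hbuv with rfl | rfl
        · rintro z (hz | rfl)
          · exact Or.inl ⟨Or.inl hz.1, hz.2⟩
          · simp
        · rintro z (hz | rfl)
          · exact Or.inl ⟨Or.inr hz.1, hz.2⟩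
          · simp
  exact (key _ h).2 (Set.mem_univ b)

/-- If no deletion is possible, each side of a small separation has at least three vertices. -/
theorem IsSmallSeparation.three_le_ncard {α : Type*} [Finite α] {K : SimpleGraph α}
    {s A B T : Set α} (h : IsSmallSeparation K s A B T) (hs : ∀ t, ¬ StarStep K s t)
    (hA : A.Nonempty) : 3 ≤ A.ncard := by
  have hAs : A ⊆ s := h.union_eq ▸ fun z hz => Or.inl (Or.inl hz)
  have hN : ∀ a ∈ A, K.neighborSet a ∩ s ⊆ A ∪ T := by
    rintro a ha z ⟨hz, hzs⟩
    rw [← h.union_eq] at hzs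
    rcases hzs with (hzA | hzB) | hzT
    exacts [Or.inl hzA, (h.not_adj a ha z hzB hz).elim, Or.inr hzT]
  have hT := h.ncard_sep_le
  have hU := Set.ncard_union_le A T
  by_contra! hlt
  obtain ⟨a, ha⟩ := hA
  by_cases h1 : ∃ b ∈ A, b ≠ a
  · obtain ⟨b, hb, hba⟩ := h1
    refine hs _ (Or.inr ⟨a, hAs ha, b, hAs hb, hba.symm, rfl, ?_⟩)
    have : ((K.neighborSet a ∪ K.neighborSet b) ∩ s ∪ {a, b}).ncard ≤ (A ∪ T).ncard := by
      refine Set.ncard_le_ncard ?_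
      rintro z (⟨hz | hz, hzs⟩ | rfl | rfl)
      exacts [hN a ha ⟨hz, hzs⟩, hN b hb ⟨hz, hzs⟩, Or.inl ha, Or.inl hb]
    omega
  · push Not at h1
    refine hs _ (Or.inl ⟨a, hAs ha, rfl, ?_⟩)
    refine (Set.ncard_le_ncard fun z hz => ?_).trans hT
    rcases hN a ha hz with hzA | hzT
    · exact (K.ne_of_adj hz.1 (h1 z hzA).symm).elim
    · exact hzT

/-- An induced subgraph that is large but not 3-connected has a small separation. -/
theorem exists_isSmallSeparation {α : Type*} [Finite α] {K : SimpleGraph α} {s : Set α}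
    (h4 : 4 ≤ s.ncard) (hs : ¬ ThreeConnected (K.induce s)) :
    ∃ A B T, IsSmallSeparation K s A B T ∧ A.Nonempty ∧ B.Nonempty := by
  have key : ∀ T ⊆ s, T.ncard ≤ 2 → ¬ (K.induce (s \ T)).Connected →
      ∃ A B T, IsSmallSeparation K s A B T ∧ A.Nonempty ∧ B.Nonempty := by
    intro T hTs hT hc
    have hne : (s \ T).Nonempty := by
      rw [← Set.ncard_pos, Set.ncard_sdiff hTs]
      omega
    have : Nonempty (s \ T : Set α) := hne.to_subtype
    obtain ⟨X, hX, hXc, hadj⟩ := SimpleGraph.exists_isolated_set_of_not_connected hc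
    refine ⟨Subtype.val '' X, Subtype.val '' Xᶜ, T, ⟨?_, ?_, ?_, ?_, hT, ?_⟩,
      hX.image _, hXc.image _⟩
    · rw [← Set.image_union, Set.union_compl_self, Set.image_univ, Subtype.range_coe,
        Set.sdiff_union_of_subset hTs]
    · exact Set.disjoint_image_of_injective Subtype.val_injective disjoint_compl_right
    · rw [Set.disjoint_left]
      rintro _ ⟨z, -, rfl⟩
      exact z.2.2
    · rw [Set.disjoint_left]
      rintro _ ⟨z, -, rfl⟩
      exact z.2.2
    · rintro _ ⟨a, ha, rfl⟩ _ ⟨b, hb, rfl⟩ hab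
      exact hadj a ha b hb hab
  simp only [ThreeConnected, not_and_or, not_forall] at hs
  rcases hs with hs | hs | ⟨T, hT, hc⟩
  · exact (hs h4).elim
  · refine key ∅ (Set.empty_subset s) (by simp) ?_
    rwa [Set.sdiff_empty]
  · refine key (Subtype.val '' T) (by simp) ?_ ?_
    · rw [Set.ncard_image_of_injective _ Subtype.val_injective, hT]
    · intro hconn
      refine hc ((SimpleGraph.Iso.connected_iff
        (⟨⟨fun z => ⟨⟨z.1, z.2.1⟩, fun hz => z.2.2 ⟨_, hz, rfl⟩⟩,
          fun z => ⟨z.1.1, z.1.2, ?_⟩, fun _ => rfl, fun _ => rfl⟩, Iff.rfl⟩ :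
          K.induce (s \ Subtype.val '' T) ≃g (K.induce s).induce Tᶜ)).1 hconn)
      rintro ⟨w, hw, hwz⟩
      exact z.2 (Subtype.ext hwz ▸ hw)

/-- An induced subgraph containing a spanning complete bipartite graph with both parts of size
at least three admits no deletion. -/
theorem not_starStep_union_of_forall_adj {α : Type*} [Finite α] {K : SimpleGraph α}
    {A B : Set α} (hAB : ∀ a ∈ A, ∀ b ∈ B, K.Adj a b) (hA : 3 ≤ A.ncard) (hB : 3 ≤ B.ncard)
    (t : Set α) : ¬ StarStep K (A ∪ B) t := by
  have hpair : ∀ A B : Set α, (∀ a ∈ A, ∀ b ∈ B, K.Adj a b) → 3 ≤ A.ncard → 3 ≤ B.ncard →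
      ∀ u ∈ A, ∀ v, v ∈ A ∪ B → u ≠ v →
      4 < ((K.neighborSet u ∪ K.neighborSet v) ∩ (A ∪ B) ∪ {u, v}).ncard := by
    intro A B hAB hA hB u hu v hv huv
    have hdisj : ∀ a ∈ A, a ∉ B := fun a ha hb => K.irrefl (hAB a ha a hb)
    rcases hv with hv | hv
    · have h1 : (B ∪ {u, v}).ncard ≤
          ((K.neighborSet u ∪ K.neighborSet v) ∩ (A ∪ B) ∪ {u, v}).ncard := by
        refine Set.ncard_le_ncard ?_
        apply Set.union_subset_union_left
        exact fun z hz => ⟨Or.inl (hAB u hu z hz), Or.inr hz⟩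
      rw [Set.ncard_union_eq, Set.ncard_pair huv] at h1
      · omega
      · rw [Set.disjoint_right]
        rintro z (rfl | rfl)
        exacts [hdisj _ hu, hdisj _ hv]
    · have h1 : (A ∪ B).ncard ≤
          ((K.neighborSet u ∪ K.neighborSet v) ∩ (A ∪ B) ∪ {u, v}).ncard := by
        refine Set.ncard_le_ncard ?_
        rintro z (hz | hz)
        · exact Or.inl ⟨Or.inr (hAB z hz v hv).symm, Or.inl hz⟩
        · exact Or.inl ⟨Or.inl (hAB u hu z hz), Or.inr hz⟩
      rw [Set.ncard_union_eq (Set.disjoint_left.2 hdisj)] at h1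
      omega
  rintro (⟨x, hx | hx, -, hd⟩ | ⟨u, hu, v, hv, huv, -, hd⟩)
  · have := Set.ncard_le_ncard (s := B) (t := K.neighborSet x ∩ (A ∪ B))
      fun z hz => ⟨hAB x hx z hz, Or.inr hz⟩
    omega
  · have := Set.ncard_le_ncard (s := A) (t := K.neighborSet x ∩ (A ∪ B))
      fun z hz => ⟨(hAB z hz x hx).symm, Or.inl hz⟩
    omega
  · rcases hu with hu | hu
    · exact absurd hd (hpair A B hAB hA hB u hu v hv huv).not_ge
    · have := hpair B A (fun b hb a ha => (hAB a ha b hb).symm) hB hA u hu v hv.symm huv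
      rw [Set.union_comm B A] at this
      omega

/-- A complete bipartite graph with both parts of size at least three lies, up to the
separator, on one side of any small separation. -/
theorem IsSmallSeparation.union_diff_subset {α : Type*} [Finite α] {K : SimpleGraph α}
    {s P Q R A B : Set α} (h : IsSmallSeparation K s P Q R)
    (hAB : ∀ a ∈ A, ∀ b ∈ B, K.Adj a b) (hA : 3 ≤ A.ncard) (hB : 3 ≤ B.ncard)
    (hs : A ∪ B ⊆ s) : (A ∪ B) \ R ⊆ P ∨ (A ∪ B) \ R ⊆ Q := by
  have hR := h.ncard_sep_le
  obtain ⟨p, hpA, hpR⟩ : ∃ p ∈ A, p ∉ R :=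
    Set.exists_mem_notMem_of_ncard_lt_ncard (by omega)
  obtain ⟨q, hqB, hqR⟩ : ∃ q ∈ B, q ∉ R :=
    Set.exists_mem_notMem_of_ncard_lt_ncard (by omega)
  have key : ∀ P Q, IsSmallSeparation K s P Q R → p ∈ P → (A ∪ B) \ R ⊆ P := by
    intro P Q h hp
    have hmem : ∀ z ∈ A ∪ B, z ∉ R → ∀ w ∈ P, K.Adj w z → z ∈ P := by
      intro z hz hzR w hw hwz
      have := hs hz
      rw [← h.union_eq] at this
      rcases this with (hzP | hzQ) | hzR'
      exacts [hzP, (h.not_adj w hw z hzQ hwz).elim, (hzR hzR').elim]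
    have hq : q ∈ P := hmem q (Or.inr hqB) hqR p hp (hAB p hpA q hqB)
    rintro z ⟨hz | hz, hzR⟩
    · exact hmem z (Or.inl hz) hzR q hq (hAB z hz q hqB).symm
    · exact hmem z (Or.inr hz) hzR p hp (hAB p hpA z hz)
  have hps := hs (Or.inl hpA)
  rw [← h.union_eq] at hps
  rcases hps with (hp | hp) | hp
  exacts [Or.inl (key P Q h hp), Or.inr (key Q P h.symm hp), (hpR hp).elim]

/-- **Lemma 5.4.** If a finite graph `H` contains an induced subgraph on at least 5
vertices that is 3-connected and not a clique, then the `3*`-core of `H` or of its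
complement is 3-connected and not a clique. -/
theorem stmt_12 {α : Type*} [Fintype α] (H : SimpleGraph α)
    (h : ∃ s : Set α, 5 ≤ s.ncard ∧ ThreeConnected (H.induce s) ∧
      ¬ IsCliqueGraph (H.induce s)) :
    GoodStarCore H ∨ GoodStarCore (Hᶜ) := by
  obtain ⟨S, hS5, hS3, hSn⟩ := h
  obtain ⟨C, hC, hCstuck⟩ := exists_starCoreSeq_stuck H
  have hSC : S ⊆ C := hC.subset_of_stuck (hS3.not_starStep hS5)
  by_cases hC3 : ThreeConnected (H.induce C)
  · exact Or.inl ⟨C, hC, hC3, fun hcl => hSn fun u v huv =>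
      hcl ⟨u.1, hSC u.2⟩ ⟨v.1, hSC v.2⟩ fun he => huv (Subtype.ext (Subtype.mk.inj he)),
      hCstuck⟩
  right
  have hSCcard := Set.ncard_le_ncard hSC
  obtain ⟨A, B, T, hsep, hAne, hBne⟩ := exists_isSmallSeparation (by omega) hC3
  have hA := hsep.three_le_ncard hCstuck hAne
  have hB := hsep.symm.three_le_ncard hCstuck hBne
  have hT := hsep.ncard_sep_le
  have hAB : ∀ a ∈ A, ∀ b ∈ B, Hᶜ.Adj a b := fun a ha b hb =>
    ⟨fun he => hsep.disjoint_left_right.ne_of_mem ha hb he, hsep.not_adj a ha b hb⟩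
  have hABC : A ∪ B ⊆ C := hsep.union_eq ▸ Set.subset_union_left
  have hABcard : (A ∪ B).ncard = A.ncard + B.ncard :=
    Set.ncard_union_eq hsep.disjoint_left_right
  obtain ⟨D, hD, hDstuck⟩ := exists_starCoreSeq_stuck Hᶜ
  have hABD : A ∪ B ⊆ D := hD.subset_of_stuck (not_starStep_union_of_forall_adj hAB hA hB)
  have hABDcard := Set.ncard_le_ncard hABD
  refine ⟨D, hD, ?_, ?_, hDstuck⟩
  · by_contra hD3
    obtain ⟨P, Q, R, hsep', hPne, hQne⟩ := exists_isSmallSeparation (by omega) hD3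
    have key : ∀ P Q, IsSmallSeparation Hᶜ D P Q R → Q.Nonempty → ¬ (A ∪ B) \ R ⊆ P := by
      intro P Q hsep' hQne hsub
      have hQ := hsep'.symm.three_le_ncard hDstuck hQne
      obtain ⟨b, hbQ, hbT⟩ : ∃ b ∈ Q, b ∉ T :=
        Set.exists_mem_notMem_of_ncard_lt_ncard (by omega)
      have hbC : b ∉ C := by
        rw [← hsep.union_eq]
        rintro (hb | hb)
        · exact hsep'.disjoint_left_right.ne_of_mem
            (hsub ⟨hb, hsep'.disjoint_right_sep.notMem_of_mem_left hbQ⟩) hbQ rfl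
        · exact hbT hb
      have h1 := hC.ncard_neighborSet_inter_le hbC
      have h2 : ((A ∪ B) \ R).ncard ≤ (H.neighborSet b ∩ C).ncard := by
        refine Set.ncard_le_ncard ?_
        intro z hz
        refine ⟨?_, hABC hz.1⟩
        by_contra hn
        exact hsep'.not_adj z (hsub hz) b hbQ
          ⟨hsep'.disjoint_left_right.ne_of_mem (hsub hz) hbQ, fun hzb => hn hzb.symm⟩
      have h3 := Set.le_ncard_sdiff R (A ∪ B)
      have := hsep'.ncard_sep_le
      omega
    rcases hsep'.union_diff_subset hAB hA hB hABD with hsub | hsub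
    exacts [key P Q hsep' hQne hsub, key Q P hsep'.symm hPne hsub]
  · intro hcl
    obtain ⟨a, ha⟩ := hAne
    refine hCstuck _ (Or.inl ⟨a, hABC (Or.inl ha), rfl, ?_⟩)
    refine (Set.ncard_le_ncard fun z hz => ?_).trans hT
    have hzC := hz.2
    rw [← hsep.union_eq] at hzC
    refine hzC.resolve_left fun hzAB => ?_
    have := hcl ⟨a, hABD (Or.inl ha)⟩ ⟨z, hABD hzAB⟩
      fun he => H.ne_of_adj hz.1 (congrArg Subtype.val he)
    exact this.2 hz.1
end

section
/- Let H be a finite graph that admits a fixing operation for a non-empty class F of H-free graphs (on countable vertex sets). Then there exists a strongly H-induced-saturated graph, i.e. a countable graph G that is H-free and such that every locally finite perturbation of G contains an induced copy of H. -/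
/-- A simple graph on a countable vertex set (a set of naturals). -/
structure CGraph where
  verts : Set ℕ
  Adj : ℕ → ℕ → Prop
  symm : ∀ ⦃a b : ℕ⦄, Adj a b → Adj b a
  loopless : ∀ a : ℕ, ¬ Adj a a
  mem_of_adj : ∀ ⦃a b : ℕ⦄, Adj a b → a ∈ verts ∧ b ∈ verts

namespace CGraph

/-- `G` contains an induced copy of the graph `H`. -/
def HasCopy (G : CGraph) {α : Type*} (H : SimpleGraph α) : Prop :=
  ∃ f : α → ℕ, Function.Injective f ∧ (∀ a : α, f a ∈ G.verts) ∧
    ∀ a b : α, G.Adj (f a) (f b) ↔ H.Adj a b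

/-- `G` is `H`-free. -/
def Free (G : CGraph) {α : Type*} (H : SimpleGraph α) : Prop := ¬ G.HasCopy H

/-- `G'` has vertex set containing that of `G` and its induced subgraph on the
vertex set of `G` equals `G`. -/
def Extends (G' G : CGraph) : Prop :=
  G.verts ⊆ G'.verts ∧ ∀ a ∈ G.verts, ∀ b ∈ G.verts, (G'.Adj a b ↔ G.Adj a b)

/-- `G'` is a locally finite perturbation of `G`. -/
def LocFinPert (G G' : CGraph) : Prop :=
  G'.verts = G.verts ∧ (∃ a b : ℕ, ¬ (G'.Adj a b ↔ G.Adj a b)) ∧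
    ∀ w : ℕ, {w' : ℕ | ¬ (G'.Adj w w' ↔ G.Adj w w')}.Finite

/-- The pair `x y` is unfixed in `G` for `H`: some locally finite perturbation of `G`
perturbs `x y` and is `H`-free. -/
def Unfixed (G : CGraph) {α : Type*} (H : SimpleGraph α) (x y : ℕ) : Prop :=
  ∃ G' : CGraph, G.LocFinPert G' ∧ ¬ (G'.Adj x y ↔ G.Adj x y) ∧ G'.Free H

/-- `G` is strongly `H`-induced-saturated. -/
def StronglySat (G : CGraph) {α : Type*} (H : SimpleGraph α) : Prop :=
  G.Free H ∧ ∀ G' : CGraph, G.LocFinPert G' → G'.HasCopy H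

end CGraph

/-- `H` admits an edge fixing operation for the class `F`. -/
def EdgeFixOp {α : Type*} (H : SimpleGraph α) (F : Set CGraph) : Prop :=
  ∀ G ∈ F, ∀ x y : ℕ, G.Adj x y →
    ∃ G' ∈ F, G'.Extends G ∧
      ∀ G'' : CGraph, G'.LocFinPert G'' → ¬ (G''.Adj x y ↔ G'.Adj x y) → G''.HasCopy H

/-- `H` admits a non-edge fixing operation for the class `F`. -/
def NonEdgeFixOp {α : Type*} (H : SimpleGraph α) (F : Set CGraph) : Prop :=
  ∀ G ∈ F, ∀ x y : ℕ, x ∈ G.verts → y ∈ G.verts → x ≠ y → ¬ G.Adj x y →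
    ∃ G' ∈ F, G'.Extends G ∧
      ∀ G'' : CGraph, G'.LocFinPert G'' → ¬ (G''.Adj x y ↔ G'.Adj x y) → G''.HasCopy H

/-- `H` admits a fixing operation for the class `F`. -/
def FixOp {α : Type*} (H : SimpleGraph α) (F : Set CGraph) : Prop :=
  EdgeFixOp H F ∧ NonEdgeFixOp H F

namespace CGraph

theorem Extends.refl (G : CGraph) : G.Extends G :=
  ⟨subset_rfl, fun _ _ _ _ => Iff.rfl⟩

theorem Extends.trans {G₁ G₂ G₃ : CGraph} (h₃₂ : G₃.Extends G₂) (h₂₁ : G₂.Extends G₁) :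
    G₃.Extends G₁ :=
  ⟨h₂₁.1.trans h₃₂.1, fun a ha b hb =>
    (h₃₂.2 a (h₂₁.1 ha) b (h₂₁.1 hb)).trans (h₂₁.2 a ha b hb)⟩

theorem HasCopy.of_extends {G G' : CGraph} {α : Type*} {H : SimpleGraph α}
    (hext : G'.Extends G) (h : G.HasCopy H) : G'.HasCopy H := by
  obtain ⟨f, hf, hmem, hadj⟩ := h
  exact ⟨f, hf, fun a => hext.1 (hmem a), fun a b =>
    (hext.2 _ (hmem a) _ (hmem b)).trans (hadj a b)⟩

/-- A copy of `H` in `G'` contained in the vertex set of `G` is a copy in `G`. -/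
theorem Extends.hasCopy_of_forall_mem {G G' : CGraph} {α : Type*} {H : SimpleGraph α}
    (hext : G'.Extends G) {f : α → ℕ} (hf : Function.Injective f) (hmem : ∀ a, f a ∈ G.verts)
    (hadj : ∀ a b, G'.Adj (f a) (f b) ↔ H.Adj a b) : G.HasCopy H :=
  ⟨f, hf, hmem, fun a b => (hext.2 _ (hmem a) _ (hmem b)).symm.trans (hadj a b)⟩

/-- The subgraph of `G` induced on the vertices in `s`. -/
def induce (G : CGraph) (s : Set ℕ) : CGraph where
  verts := G.verts ∩ s
  Adj a b := a ∈ s ∧ b ∈ s ∧ G.Adj a b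
  symm _ _ h := ⟨h.2.1, h.1, G.symm h.2.2⟩
  loopless a h := G.loopless a h.2.2
  mem_of_adj _ _ h := ⟨⟨(G.mem_of_adj h.2.2).1, h.1⟩, ⟨(G.mem_of_adj h.2.2).2, h.2.1⟩⟩

theorem extends_induce (G : CGraph) (s : Set ℕ) : G.Extends (G.induce s) :=
  ⟨Set.inter_subset_left, fun _ ha _ hb => ⟨fun h => ⟨ha.2, hb.2, h⟩, fun h => h.2.2⟩⟩

/-- A pair that cannot be perturbed in an induced subgraph cannot be perturbed in the
whole graph. -/
theorem Unfixed.of_extends {G G' : CGraph} {α : Type*} {H : SimpleGraph α} {x y : ℕ}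
    (hext : G'.Extends G) (hx : x ∈ G.verts) (hy : y ∈ G.verts) (h : G'.Unfixed H x y) :
    G.Unfixed H x y := by
  obtain ⟨K, ⟨hverts, -, hfin⟩, hxy, hfree⟩ := h
  have hadj : ∀ a b, ¬ ((K.induce G.verts).Adj a b ↔ G.Adj a b) → ¬ (K.Adj a b ↔ G'.Adj a b) := by
    intro a b hab h
    by_cases ha : a ∈ G.verts
    · by_cases hb : b ∈ G.verts
      · exact hab ⟨fun k => (hext.2 a ha b hb).1 (h.1 k.2.2),
          fun k => ⟨ha, hb, h.2 ((hext.2 a ha b hb).2 k)⟩⟩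
      · exact hab ⟨fun k => absurd k.2.1 hb, fun k => absurd (G.mem_of_adj k).2 hb⟩
    · exact hab ⟨fun k => absurd k.1 ha, fun k => absurd (G.mem_of_adj k).1 ha⟩
  have hxy' : ¬ ((K.induce G.verts).Adj x y ↔ G.Adj x y) := fun h =>
    hxy (((extends_induce K G.verts).2 x ⟨hverts ▸ hext.1 hx, hx⟩ y ⟨hverts ▸ hext.1 hy, hy⟩).trans
      (h.trans (hext.2 x hx y hy).symm))
  refine ⟨K.induce G.verts, ⟨?_, ⟨x, y, hxy'⟩, fun w => (hfin w).subset fun w' => hadj w w'⟩, hxy',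
    fun h => hfree (h.of_extends (extends_induce K _))⟩
  change K.verts ∩ G.verts = G.verts
  rw [hverts]
  exact Set.inter_eq_right.2 hext.1

/-- The union of a sequence of graphs. -/
def iUnion (G : ℕ → CGraph) : CGraph where
  verts := ⋃ n, (G n).verts
  Adj a b := ∃ n, (G n).Adj a b
  symm _ _ := fun ⟨n, h⟩ => ⟨n, (G n).symm h⟩
  loopless a := fun ⟨n, h⟩ => (G n).loopless a h
  mem_of_adj _ _ := fun ⟨n, h⟩ =>
    ⟨Set.mem_iUnion.2 ⟨n, ((G n).mem_of_adj h).1⟩, Set.mem_iUnion.2 ⟨n, ((G n).mem_of_adj h).2⟩⟩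

section Chain

variable {G : ℕ → CGraph}

theorem extends_of_le (hG : ∀ n, (G (n + 1)).Extends (G n)) {m n : ℕ} (hmn : m ≤ n) :
    (G n).Extends (G m) := by
  induction n, hmn using Nat.le_induction with
  | base => exact Extends.refl _
  | succ n _ ih => exact (hG n).trans ih

theorem iUnion_extends (hG : ∀ n, (G (n + 1)).Extends (G n)) (n : ℕ) :
    (iUnion G).Extends (G n) := by
  refine ⟨Set.subset_iUnion (fun n => (G n).verts) n, fun a ha b hb => ⟨?_, fun h => ⟨n, h⟩⟩⟩
  rintro ⟨m, hm⟩
  rcases le_total m n with hmn | hnm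
  · have hmem := (G m).mem_of_adj hm
    exact ((extends_of_le hG hmn).2 a hmem.1 b hmem.2).2 hm
  · exact ((extends_of_le hG hnm).2 a ha b hb).1 hm

/-- The union of a chain of `H`-free graphs is `H`-free when `H` is finite. -/
theorem free_iUnion (hG : ∀ n, (G (n + 1)).Extends (G n)) {α : Type*} [Finite α]
    {H : SimpleGraph α} (hfree : ∀ n, (G n).Free H) : (iUnion G).Free H := by
  rintro ⟨f, hf, hmem, hadj⟩
  choose k hk using fun a => Set.mem_iUnion.1 (hmem a)
  obtain ⟨N, hN⟩ := Finite.exists_le k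
  exact hfree N ((iUnion_extends hG N).hasCopy_of_forall_mem hf
    (fun a => (extends_of_le hG (hN a)).1 (hk a)) hadj)

end Chain

/-- A perturbed pair consists of two distinct vertices. -/
theorem LocFinPert.mem_of_perturbed {G G' : CGraph} (h : G.LocFinPert G') {x y : ℕ}
    (hxy : ¬ (G'.Adj x y ↔ G.Adj x y)) : x ∈ G.verts ∧ y ∈ G.verts ∧ x ≠ y := by
  have hne : x ≠ y := by
    rintro rfl
    exact hxy (iff_of_false (G'.loopless x) (G.loopless x))
  have hadj : G'.Adj x y ∨ G.Adj x y := by tauto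
  rcases hadj with hadj | hadj
  · have hmem := G'.mem_of_adj hadj
    rw [h.1] at hmem
    exact ⟨hmem.1, hmem.2, hne⟩
  · exact ⟨(G.mem_of_adj hadj).1, (G.mem_of_adj hadj).2, hne⟩

end CGraph

/-- A fixing operation extends any graph of the class, within the class, so as to fix a
given pair of distinct vertices. -/
theorem FixOp.exists_extends {α : Type*} {H : SimpleGraph α} {F : Set CGraph} (hfix : FixOp H F)
    {G : CGraph} (hG : G ∈ F) (x y : ℕ) :
    ∃ G' ∈ F, G'.Extends G ∧ (x ∈ G.verts → y ∈ G.verts → x ≠ y → ¬ G'.Unfixed H x y) := by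
  by_cases h : x ∈ G.verts ∧ y ∈ G.verts ∧ x ≠ y
  · obtain ⟨hx, hy, hxy⟩ := h
    have key : ∃ G' ∈ F, G'.Extends G ∧ ∀ G'' : CGraph, G'.LocFinPert G'' →
        ¬ (G''.Adj x y ↔ G'.Adj x y) → G''.HasCopy H := by
      by_cases hadj : G.Adj x y
      · exact hfix.1 G hG x y hadj
      · exact hfix.2 G hG x y hx hy hxy hadj
    obtain ⟨G', hG', hext, hcopy⟩ := key
    exact ⟨G', hG', hext, fun _ _ _ ⟨K, hK, hKxy, hKfree⟩ => hKfree (hcopy K hK hKxy)⟩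
  · exact ⟨G, hG, CGraph.Extends.refl G, fun hx hy hxy => absurd ⟨hx, hy, hxy⟩ h⟩

/-- **Lemma 6.4.** If a finite graph `H` admits a fixing operation for a non-empty class
of `H`-free graphs, then there is a strongly `H`-induced-saturated (countable) graph. -/
theorem stmt_16 {α : Type*} [Fintype α] (H : SimpleGraph α) (F : Set CGraph)
    (hne : F.Nonempty) (hfree : ∀ G ∈ F, G.Free H) (hfix : FixOp H F) :
    ∃ G : CGraph, G.StronglySat H := by
  obtain ⟨G₀, hG₀⟩ := hne
  choose! next hnext_mem hnext_ext hnext_fix using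
    fun (G : CGraph) (hG : G ∈ F) (p : ℕ × ℕ) => hfix.exists_extends hG p.1 p.2
  -- Every pair of naturals occurs as `pair n` for arbitrarily large `n`.
  let pair : ℕ → ℕ × ℕ := fun n => (Nat.unpair n).1.unpair
  let S : ℕ → CGraph := fun n => Nat.rec G₀ (fun n G => next G (pair n)) n
  have hS : ∀ n, S n ∈ F := by
    intro n
    induction n with
    | zero => exact hG₀
    | succ n ih => exact hnext_mem _ ih (pair n)
  have hext : ∀ n, (S (n + 1)).Extends (S n) := fun n => hnext_ext _ (hS n) (pair n)
  refine ⟨CGraph.iUnion S, CGraph.free_iUnion hext fun n => hfree _ (hS n), fun G' hG' => ?_⟩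
  obtain ⟨x, y, hxy⟩ := hG'.2.1
  obtain ⟨hx, hy, hne⟩ := hG'.mem_of_perturbed hxy
  obtain ⟨i, hi⟩ := Set.mem_iUnion.1 hx
  obtain ⟨j, hj⟩ := Set.mem_iUnion.1 hy
  let n := Nat.pair (Nat.pair x y) (max i j)
  have hn : max i j ≤ n := Nat.right_le_pair _ _
  have hpair : pair n = (x, y) := by simp [pair, n]
  have hxn : x ∈ (S n).verts := (CGraph.extends_of_le hext ((le_max_left i j).trans hn)).1 hi
  have hyn : y ∈ (S n).verts := (CGraph.extends_of_le hext ((le_max_right i j).trans hn)).1 hj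
  have hfixed : ¬ (S (n + 1)).Unfixed H x y := by
    have h := hnext_fix (S n) (hS n) (pair n)
    have hsucc : S (n + 1) = next (S n) (pair n) := rfl
    rw [← hsucc, hpair] at h
    exact h hxn hyn hne
  by_contra hcopy
  exact hfixed (CGraph.Unfixed.of_extends (CGraph.iUnion_extends hext (n + 1))
    ((hext n).1 hxn) ((hext n).1 hyn) ⟨G', hG', hxy, hcopy⟩)
end
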